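/- arXiv:2405.04676 — 4 statements merged into one kernel-verified Lean document; each statement's English description precedes it below -/
import Mathlib

section
/- Let (X, μ) be a probability space and T : X → X a measure-preserving map that is ergodic with respect to μ. Let α₁ < α₂ be real numbers, ε > 0, and let φ : X → ℝ be an integrable function with φ(x) > α₁ for every x ∈ X and ∫ φ dμ ≤ α₂. Then the set Z = { x ∈ X : for every integer n ≥ 1, φ(x) + φ(T x) + ⋯ + φ(T^{n-1} x) ≤ (α₂ + ε)·n } satisfies μ(Z) ≥ ε/(α₂ + ε − α₁). -/
open MeasureTheory Finset

noncomputable def plissM {X : Type*} (T : X → X) (f : X → ℝ) : ℕ → X → ℝ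
  | 0 => fun _ => 0
  | n + 1 => fun x => max 0 (f x + plissM T f n (T x))

lemma plissM_nonneg {X : Type*} (T : X → X) (f : X → ℝ) (n : ℕ) (x : X) : 0 ≤ plissM T f n x := by
  cases n with
  | zero => exact le_rfl
  | succ n => exact le_max_left _ _

lemma plissM_mono {X : Type*} (T : X → X) (f : X → ℝ) (n : ℕ) (x : X) :
    plissM T f n x ≤ plissM T f (n + 1) x := by
  induction n generalizing x with
  | zero => exact plissM_nonneg T f 1 x
  | succ n ih =>
    show max 0 (f x + plissM T f n (T x)) ≤ max 0 (f x + plissM T f (n + 1) (T x))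
    exact max_le_max le_rfl (add_le_add le_rfl (ih _))

lemma plissM_sum {X : Type*} (T : X → X) (f : X → ℝ) (n : ℕ) (x : X) :
    ∑ i ∈ Finset.range n, f (T^[i] x) ≤ plissM T f n x := by
  induction n generalizing x with
  | zero => simp [plissM]
  | succ n ih =>
    rw [Finset.sum_range_succ']
    have := ih (T x)
    refine le_trans ?_ (le_max_right _ _)
    simp only [Function.iterate_succ_apply, Function.iterate_zero, id]
    linarith

lemma plissM_int {X : Type*} [MeasurableSpace X] {μ : Measure X} [IsProbabilityMeasure μ]
    {T : X → X} (hT : MeasurePreserving T μ μ) {f : X → ℝ} (hf : Integrable f μ) (n : ℕ) :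
    Integrable (plissM T f n) μ := by
  induction n with
  | zero => exact integrable_zero _ _ _
  | succ n ih =>
    exact (integrable_zero _ _ _).sup (hf.add (hT.integrable_comp_of_integrable ih))

/-- Measure-theoretic uniform Pliss block estimate: for an ergodic measure-preserving map
`T` of a probability space and an integrable `φ > α₁` with mean at most `α₂`, the set of
points all of whose Birkhoff sums are at most `(α₂ + ε)·n` has measure at least
`ε / (α₂ + ε - α₁)`. -/
theorem pliss_measure {X : Type*} [MeasurableSpace X] (μ : Measure X) [IsProbabilityMeasure μ]
    (T : X → X) (hT : Ergodic T μ)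
    (α₁ α₂ ε : ℝ) (hα : α₁ < α₂) (hε : 0 < ε)
    (φ : X → ℝ) (hint : Integrable φ μ) (hφ : ∀ x, α₁ < φ x)
    (hmean : ∫ x, φ x ∂μ ≤ α₂) :
    ENNReal.ofReal (ε / (α₂ + ε - α₁)) ≤
      μ {x | ∀ n : ℕ, 1 ≤ n → (∑ i ∈ Finset.range n, φ (T^[i] x)) ≤ (α₂ + ε) * n} := by
  have hP : MeasurePreserving T μ μ := hT.toMeasurePreserving
  set f : X → ℝ := fun x => φ x - (α₂ + ε) with hfdef
  have hf : Integrable f μ := hint.sub (integrable_const _)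
  have hK : 0 < α₂ + ε - α₁ := by linarith
  have hMi := plissM_int hP hf
  let Z : ℕ → Set X := fun N => {x | plissM T f N x ≤ 0}
  have hZ : ∀ N, NullMeasurableSet (Z N) μ := fun N =>
    nullMeasurableSet_le (hMi N).aemeasurable aemeasurable_const
  have hanti : Antitone Z := antitone_nat_of_succ_le fun n x hx =>
    le_trans (plissM_mono T f n x) hx
  have key : ∀ N, ENNReal.ofReal (ε / (α₂ + ε - α₁)) ≤ μ (Z (N + 1)) := by
    intro N
    have hcomp : Integrable (fun x => plissM T f (N + 1) (T x)) μ :=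
      hP.integrable_comp_of_integrable (hMi (N + 1))
    have hind : Integrable ((Z (N + 1)).indicator fun _ => (α₂ + ε - α₁)) μ :=
      (integrable_const _).indicator₀ (hZ _)
    have hpt : ∀ x, plissM T f (N + 1) x - plissM T f (N + 1) (T x) ≤
        f x + (Z (N + 1)).indicator (fun _ => (α₂ + ε - α₁)) x := by
      intro x
      by_cases hx : x ∈ Z (N + 1)
      · rw [Set.indicator_of_mem hx]
        have h1 : plissM T f (N + 1) x ≤ 0 := hx
        have h2 := plissM_nonneg T f (N + 1) (T x)
        have h3 := hφ x
        simp only [hfdef] at *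
        linarith
      · rw [Set.indicator_of_notMem hx]
        have h1 : 0 < plissM T f (N + 1) x := not_le.mp hx
        have h2 := plissM_mono T f N (T x)
        have h3 : plissM T f (N + 1) x = max 0 (f x + plissM T f N (T x)) := rfl
        rcases max_cases 0 (f x + plissM T f N (T x)) with h | h <;> linarith
    have hI := integral_mono ((hMi (N + 1)).sub hcomp) (hf.add hind) hpt
    have e1 : ∫ x, plissM T f (N + 1) (T x) ∂μ = ∫ x, plissM T f (N + 1) x ∂μ := by
      have := integral_map (μ := μ) (φ := T) hP.measurable.aemeasurable
        (f := plissM T f (N + 1)) (by rw [hP.map_eq]; exact (hMi _).aestronglyMeasurable)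
      rw [hP.map_eq] at this
      exact this.symm
    have e2 : ∫ x, f x ∂μ ≤ -ε := by
      rw [hfdef, integral_sub hint (integrable_const _)]
      simp
      linarith
    simp only [Pi.sub_apply, Pi.add_apply] at hI
    rw [integral_sub (hMi _) hcomp, integral_add hf hind, e1, integral_indicator₀ (hZ _),
      setIntegral_const, smul_eq_mul] at hI
    rw [← ofReal_measureReal]
    apply ENNReal.ofReal_le_ofReal
    rw [div_le_iff₀ hK]
    linarith
  have hlim := tendsto_measure_iInter_atTop (μ := μ) hZ hanti ⟨0, measure_ne_top _ _⟩
  have hle : ENNReal.ofReal (ε / (α₂ + ε - α₁)) ≤ μ (⋂ n, Z n) :=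
    ge_of_tendsto hlim (by
      filter_upwards [Filter.eventually_ge_atTop 1] with n hn
      obtain ⟨m, rfl⟩ := Nat.exists_eq_add_of_le' hn
      exact key m)
  refine hle.trans (measure_mono ?_)
  intro x hx n _
  have h1 : plissM T f n x ≤ 0 := Set.mem_iInter.mp hx n
  have h2 := plissM_sum T f n x
  simp only [hfdef, Finset.sum_sub_distrib, Finset.sum_const, Finset.card_range,
    nsmul_eq_mul] at h1 h2
  linarith
end

section
/- Let X be a Hausdorff space, Y a T1 space, T : X → X a continuous map, π : X → Y a continuous map, and K ⊆ Y a subset. Suppose X₀ ⊆ X is a compact set with T(X₀) ⊆ X₀ and K ⊆ π(X₀). Then there exists a compact set X₁ ⊆ X₀ with T(X₁) ⊆ X₁ and K ⊆ π(X₁) which is minimal with respect to inclusion among all such sets; that is, every compact set X₂ ⊆ X₁ with T(X₂) ⊆ X₂ and K ⊆ π(X₂) equals X₁. -/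
open Set

/-- Zorn's-lemma step: among compact `T`-invariant subsets of a compact invariant set `X₀`
whose image under `π` covers `K`, there is a minimal one. -/
theorem exists_minimal_compact_invariant {X Y : Type*}
    [TopologicalSpace X] [T2Space X] [TopologicalSpace Y] [T1Space Y]
    (T : X → X) (π : X → Y) (hT : Continuous T) (hπ : Continuous π)
    (K : Set Y) (X₀ : Set X) (hX₀ : IsCompact X₀) (hinv : T '' X₀ ⊆ X₀)
    (hK : K ⊆ π '' X₀) :
    ∃ X₁ ⊆ X₀, IsCompact X₁ ∧ T '' X₁ ⊆ X₁ ∧ K ⊆ π '' X₁ ∧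
      ∀ X₂ ⊆ X₁, IsCompact X₂ → T '' X₂ ⊆ X₂ → K ⊆ π '' X₂ → X₂ = X₁ := by
  have H : ∀ c ⊆ {S : Set X | IsCompact S ∧ T '' S ⊆ S ∧ K ⊆ π '' S}, IsChain (· ⊆ ·) c →
      c.Nonempty → ∃ lb ∈ {S : Set X | IsCompact S ∧ T '' S ⊆ S ∧ K ⊆ π '' S},
        ∀ s ∈ c, lb ⊆ s := by
    intro c hc hch hne
    refine ⟨⋂₀ c, ⟨?_, ?_, ?_⟩, fun s hs => sInter_subset_of_mem hs⟩
    · obtain ⟨s, hs⟩ := hne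
      exact (hc hs).1.of_isClosed_subset
        (isClosed_sInter fun t ht => (hc ht).1.isClosed) (sInter_subset_of_mem hs)
    · rintro _ ⟨x, hx, rfl⟩ s hs
      exact (hc hs).2.1 ⟨x, hx s hs, rfl⟩
    · intro y hy
      have hcl : IsClosed (π ⁻¹' {y}) := isClosed_singleton.preimage hπ
      have : Nonempty c := hne.to_subtype
      have hN : (⋂ s : c, (s : Set X) ∩ π ⁻¹' {y}).Nonempty := by
        refine IsCompact.nonempty_iInter_of_directed_nonempty_isCompact_isClosed
          (fun s : c => (s : Set X) ∩ π ⁻¹' {y}) ?_ ?_ ?_ ?_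
        · intro a b
          rcases hch.total a.2 b.2 with h | h
          · exact ⟨a, Subset.rfl, inter_subset_inter_left _ h⟩
          · exact ⟨b, inter_subset_inter_left _ h, Subset.rfl⟩
        · intro s
          obtain ⟨x, hx, hxy⟩ := (hc s.2).2.2 hy
          exact ⟨x, hx, hxy⟩
        · exact fun s => (hc s.2).1.inter_right hcl
        · exact fun s => (hc s.2).1.isClosed.inter hcl
      obtain ⟨x, hx⟩ := hN
      rw [mem_iInter] at hx
      obtain ⟨s, hs⟩ := hne
      exact ⟨x, fun t ht => (hx ⟨t, ht⟩).1, (hx ⟨s, hs⟩).2⟩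
  obtain ⟨m, hm, hmin⟩ := zorn_superset_nonempty _ H X₀ ⟨hX₀, hinv, hK⟩
  refine ⟨m, hm, hmin.prop.1, hmin.prop.2.1, hmin.prop.2.2, ?_⟩
  intro X₂ h2 hc hi hk
  exact Subset.antisymm h2 (hmin.le_of_le ⟨hc, hi, hk⟩ h2)
end

section
/- Let X be a compact Hausdorff space and T : X → X a continuous map; let Y be a Hausdorff space, f : Y → Y a continuous map, and π : X → Y a continuous map satisfying π ∘ T = f ∘ π. Let K ⊆ Y and suppose that K ⊆ π(X) and that there exists y₀ ∈ K with ω(f, y₀) = K. Then there exists a point p ∈ X with p ∈ ω(T, p) and π(ω(T, p)) = K. Consequently X' := ω(T, p) is a compact set with T(X') ⊆ X', π(X') = K, and the forward orbit {T^n(p) : n ≥ 0} of p ∈ X' is dense in X'. -/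
open Set

/-- The ω-limit set of a point `x` under a map `T`:
`ω(T, x) = ⋂_{m ≥ 0} closure { T^n x : n ≥ m }`. -/
def omegaLimitSet {X : Type*} [TopologicalSpace X] (T : X → X) (x : X) : Set X :=
  ⋂ m : ℕ, closure ((fun n : ℕ => T^[n] x) '' {n | m ≤ n})

theorem omega_image_aux {X Y : Type*}
    [TopologicalSpace X] [CompactSpace X] [T2Space X] [TopologicalSpace Y] [T2Space Y]
    (T : X → X) (f : Y → Y) (π : X → Y) (hπ : Continuous π)
    (hsemi : π ∘ T = f ∘ π) (p : X) :
    π '' omegaLimitSet T p = omegaLimitSet f (π p) := by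
  have hs : ∀ n : ℕ, π (T^[n] p) = f^[n] (π p) := fun n =>
    (Function.Semiconj.iterate_right (f := π) (ga := T) (gb := f)
      (fun x => congrFun hsemi x) n) p
  have him : ∀ m : ℕ, π '' ((fun n : ℕ => T^[n] p) '' {n | m ≤ n}) =
      (fun n : ℕ => f^[n] (π p)) '' {n | m ≤ n} := by
    intro m
    rw [Set.image_image]
    simp only [hs]
  apply Set.Subset.antisymm
  · rintro _ ⟨x, hx, rfl⟩
    refine Set.mem_iInter.2 fun m => ?_
    rw [← him m]
    exact image_closure_subset_closure_image hπ ⟨x, Set.mem_iInter.1 hx m, rfl⟩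
  · intro y hy
    have key : (⋂ m : ℕ, (π ⁻¹' {y} ∩
        closure ((fun n : ℕ => T^[n] p) '' {n | m ≤ n}))).Nonempty := by
      have hcl : ∀ m : ℕ, IsClosed (π ⁻¹' {y} ∩
        closure ((fun n : ℕ => T^[n] p) '' {n | m ≤ n})) := fun m =>
          (isClosed_singleton.preimage hπ).inter isClosed_closure
      apply IsCompact.nonempty_iInter_of_directed_nonempty_isCompact_isClosed
      · apply directed_of_isDirected_le
        intro a b hab
        exact Set.inter_subset_inter_right _ (closure_mono (Set.image_mono
          fun n (hn : b ≤ n) => le_trans hab hn))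
      · intro m
        have h1 := Set.mem_iInter.1 hy m
        rw [← him m] at h1
        have hc : IsClosed (π '' closure ((fun n : ℕ => T^[n] p) '' {n | m ≤ n})) :=
          (isClosed_closure.isCompact.image hπ).isClosed
        obtain ⟨x, hx, hxy⟩ := closure_minimal (Set.image_mono subset_closure) hc h1
        exact ⟨x, hxy, hx⟩
      · exact fun m => (hcl m).isCompact
      · exact hcl
    obtain ⟨x, hx⟩ := key
    rw [Set.mem_iInter] at hx
    exact ⟨x, Set.mem_iInter.2 fun m => (hx m).2, (hx 0).1⟩

theorem omega_invariant_aux {X : Type*} [TopologicalSpace X] (T : X → X)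
    (hT : Continuous T) (p : X) : T '' omegaLimitSet T p ⊆ omegaLimitSet T p := by
  rintro _ ⟨x, hx, rfl⟩
  refine Set.mem_iInter.2 fun m => ?_
  have h := image_closure_subset_closure_image hT ⟨x, Set.mem_iInter.1 hx m, rfl⟩
  refine closure_mono ?_ h
  rintro _ ⟨_, ⟨n, hn, rfl⟩, rfl⟩
  exact ⟨n + 1, Nat.le_succ_of_le hn, Function.iterate_succ_apply' T n p⟩

theorem omega_closed_aux {X : Type*} [TopologicalSpace X] (T : X → X) (p : X) :
    IsClosed (omegaLimitSet T p) := isClosed_iInter fun _ => isClosed_closure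

/-- Topological content of Step 2 in the proof of property (Ĉ9): if a set `K ⊆ Y` is
contained in the image of a continuous semiconjugacy `π : X → Y` from a compact Hausdorff
space, and `K` is the ω-limit set of one of its points, then `K` lifts to a transitive
compact invariant set in `X`, namely `ω(T, p)` for a point `p` recurrent to it. -/
theorem transitive_compact_lift {X Y : Type*}
    [TopologicalSpace X] [CompactSpace X] [T2Space X] [TopologicalSpace Y] [T2Space Y]
    (T : X → X) (f : Y → Y) (π : X → Y)
    (hT : Continuous T) (hf : Continuous f) (hπ : Continuous π)
    (hsemi : π ∘ T = f ∘ π)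
    (K : Set Y) (hK : K ⊆ Set.range π)
    (y₀ : Y) (hy₀ : y₀ ∈ K) (hω : omegaLimitSet f y₀ = K) :
    ∃ p : X, p ∈ omegaLimitSet T p ∧ π '' omegaLimitSet T p = K ∧
      IsCompact (omegaLimitSet T p) ∧
      T '' omegaLimitSet T p ⊆ omegaLimitSet T p ∧
      omegaLimitSet T p ⊆ closure (Set.range fun n : ℕ => T^[n] p) := by
  obtain ⟨M, hM⟩ := zorn_superset
    {M : Set X | IsClosed M ∧ Set.MapsTo T M M ∧ (π ⁻¹' {y₀} ∩ M).Nonempty} (by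
      intro c hc hchain
      rcases c.eq_empty_or_nonempty with rfl | hne
      · obtain ⟨x, hx⟩ := hK hy₀
        exact ⟨Set.univ, ⟨isClosed_univ, Set.mapsTo_univ _ _, x, hx, trivial⟩, by simp⟩
      · refine ⟨⋂₀ c, ⟨isClosed_sInter fun s hs => (hc hs).1, ?_, ?_⟩,
          fun s hs => Set.sInter_subset_of_mem hs⟩
        · intro x hx s hs
          exact (hc hs).2.1 (hx s hs)
        · have : Nonempty c := hne.to_subtype
          have hcl : ∀ s : c, IsClosed (π ⁻¹' {y₀} ∩ (s : Set X)) := fun s =>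
            (isClosed_singleton.preimage hπ).inter (hc s.2).1
          have key : (⋂ s : c, (π ⁻¹' {y₀} ∩ (s : Set X))).Nonempty := by
            apply IsCompact.nonempty_iInter_of_directed_nonempty_isCompact_isClosed
            · intro a b
              rcases hchain.total a.2 b.2 with h | h
              · exact ⟨a, subset_rfl, Set.inter_subset_inter_right _ h⟩
              · exact ⟨b, Set.inter_subset_inter_right _ h, subset_rfl⟩
            · exact fun s => (hc s.2).2.2
            · exact fun s => (hcl s).isCompact
            · exact hcl
          obtain ⟨x, hx⟩ := key
          rw [Set.mem_iInter] at hx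
          exact ⟨x, (hx (Classical.arbitrary c)).1, fun s hs => (hx ⟨s, hs⟩).2⟩)
  obtain ⟨hMc, hMT, p, hp, hpM⟩ := hM.prop
  have hp : π p = y₀ := hp
  have himg : π '' omegaLimitSet T p = K := by
    rw [omega_image_aux T f π hπ hsemi p, hp, hω]
  have hinv := omega_invariant_aux T hT p
  have hcl := omega_closed_aux T p
  have hsub : omegaLimitSet T p ⊆ M := by
    intro x hx
    refine closure_minimal ?_ hMc (Set.mem_iInter.1 hx 0)
    rintro _ ⟨n, -, rfl⟩
    exact hMT.iterate n hpM
  have hmem : (π ⁻¹' {y₀} ∩ omegaLimitSet T p).Nonempty := by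
    rw [← himg] at hy₀
    obtain ⟨x, hx, hxy⟩ := hy₀
    exact ⟨x, hxy, hx⟩
  have hle : M ⊆ omegaLimitSet T p :=
    hM.le_of_le ⟨hcl, Set.mapsTo_iff_image_subset.2 hinv, hmem⟩ hsub
  refine ⟨p, hle hpM, himg, hcl.isCompact, hinv, fun x hx => ?_⟩
  exact closure_mono (Set.image_subset_range _ _) (Set.mem_iInter.1 hx 0)
end

section
/- Let E be a 2-dimensional real inner product space, let A : E → E be an invertible linear map, let v ∈ E be a unit vector and V = span(v). Denote by P_{V^⊥} and P_{(A V)^⊥} the orthogonal projections of E onto the orthogonal complements of V and of A(V), respectively. Then the operator norm of the composition P_{(A V)^⊥} ∘ A ∘ P_{V^⊥} equals |det A| / ‖A v‖. -/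
open Submodule

/-- The orthogonal projection of `E` onto the orthogonal complement of the line
spanned by `v`, viewed as a continuous linear map `E →L[ℝ] E`. -/
noncomputable def projLinePerp {E : Type*} [NormedAddCommGroup E] [InnerProductSpace ℝ E]
    [FiniteDimensional ℝ E] (v : E) : E →L[ℝ] E :=
  ((ℝ ∙ v)ᗮ).subtypeL.comp (orthogonalProjection ((ℝ ∙ v)ᗮ))

lemma areaForm_projLinePerp {E : Type*} [NormedAddCommGroup E] [InnerProductSpace ℝ E]
    [FiniteDimensional ℝ E] [Fact (Module.finrank ℝ E = 2)] (o : Orientation ℝ E (Fin 2))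
    (a x : E) : o.areaForm a (projLinePerp a x) = o.areaForm a x := by
  have h1 : x - projLinePerp a x ∈ (ℝ ∙ a) := by
    have := Submodule.sub_starProjection_mem_orthogonal (K := (ℝ ∙ a)ᗮ) x
    rw [Submodule.orthogonal_orthogonal] at this
    exact this
  obtain ⟨c, hc⟩ := Submodule.mem_span_singleton.1 h1
  have h2 : o.areaForm a (x - projLinePerp a x) = 0 := by rw [← hc]; simp
  rw [map_sub] at h2
  linarith

lemma norm_projLinePerp_mul {E : Type*} [NormedAddCommGroup E] [InnerProductSpace ℝ E]
    [FiniteDimensional ℝ E] [Fact (Module.finrank ℝ E = 2)] (o : Orientation ℝ E (Fin 2))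
    (a x : E) : ‖a‖ * ‖projLinePerp a x‖ = |o.areaForm a x| := by
  have h0 : projLinePerp a x ∈ (ℝ ∙ a)ᗮ := by
    unfold projLinePerp
    exact Subtype.coe_prop _
  rw [← areaForm_projLinePerp, o.abs_areaForm_of_orthogonal]
  exact Submodule.mem_orthogonal_singleton_iff_inner_right.1 h0

lemma areaForm_map_det {E : Type*} [NormedAddCommGroup E] [InnerProductSpace ℝ E]
    [FiniteDimensional ℝ E] [Fact (Module.finrank ℝ E = 2)] (o : Orientation ℝ E (Fin 2))
    (f : E →ₗ[ℝ] E) (x y : E) :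
    o.areaForm (f x) (f y) = LinearMap.det f * o.areaForm x y := by
  have e : Module.Basis (Fin 2) ℝ E := Module.finBasisOfFinrankEq ℝ E Fact.out
  have h : ![f x, f y] = f ∘ ![x, y] := by ext i; fin_cases i <;> rfl
  rw [o.areaForm_to_volumeForm, o.areaForm_to_volumeForm, h,
    AlternatingMap.eq_smul_basis_det e o.volumeForm]
  simp only [AlternatingMap.smul_apply, smul_eq_mul, Module.Basis.det_comp]
  ring

/-- In a 2-dimensional real inner product space, for an invertible linear map `A` and a
unit vector `v` spanning the line `V = span v` (so that `A V = span (A v)`), the operator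
norm of `P_{(A V)^⊥} ∘ A ∘ P_{V^⊥}` equals `|det A| / ‖A v‖`. -/
theorem norm_proj_comp_proj {E : Type*} [NormedAddCommGroup E] [InnerProductSpace ℝ E]
    [FiniteDimensional ℝ E] (hdim : Module.finrank ℝ E = 2)
    (A : E ≃ₗ[ℝ] E) (v : E) (hv : ‖v‖ = 1) :
    ‖(projLinePerp (A v)).comp
        ((LinearMap.toContinuousLinearMap (A : E →ₗ[ℝ] E)).comp (projLinePerp v))‖ =
      |LinearMap.det (A : E →ₗ[ℝ] E)| / ‖A v‖ := by
  haveI : Fact (Module.finrank ℝ E = 2) := ⟨hdim⟩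
  have o : Orientation ℝ E (Fin 2) :=
    (Module.finBasisOfFinrankEq ℝ E hdim).orientation
  have hAv : 0 < ‖A v‖ := by
    rw [norm_pos_iff]
    intro h
    have : v = 0 := by simpa using h
    simp [this] at hv
  have key : ∀ x, ‖((projLinePerp (A v)).comp
        ((LinearMap.toContinuousLinearMap (A : E →ₗ[ℝ] E)).comp (projLinePerp v))) x‖ =
      |LinearMap.det (A : E →ₗ[ℝ] E)| / ‖A v‖ * |o.areaForm v x| := by
    intro x
    have h1 := norm_projLinePerp_mul o (A v) (A (projLinePerp v x))
    have h2 := areaForm_map_det o (A : E →ₗ[ℝ] E) v (projLinePerp v x)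
    simp only [LinearEquiv.coe_coe] at h2
    rw [h2, areaForm_projLinePerp, abs_mul] at h1
    rw [div_mul_eq_mul_div, eq_div_iff hAv.ne', mul_comm, ← h1]
    rfl
  apply le_antisymm
  · apply ContinuousLinearMap.opNorm_le_bound _ (by positivity)
    intro x
    rw [key]
    gcongr
    simpa [hv] using o.abs_areaForm_le v x
  · have h := ContinuousLinearMap.le_opNorm ((projLinePerp (A v)).comp
        ((LinearMap.toContinuousLinearMap (A : E →ₗ[ℝ] E)).comp (projLinePerp v)))
        (o.rightAngleRotation v)
    rw [key] at h
    simpa [hv] using h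
end
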